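/- arXiv:1506.05848 — 2 statements merged into one kernel-verified Lean document; each statement's English description precedes it below -/
import Mathlib

section
/- Let p and s be nonzero pure vector quaternions. If U ∈ Π_{p,s} and |U| = 1, then U p̂ U* = ŝ. -/
open Quaternion
open scoped InnerProductSpace Classical

/-- The 2-plane `ℂ_u = ℝ + ℝ u` spanned by `1` and `u` in the quaternions. -/
def complexPlane (u : ℍ[ℝ]) : Set ℍ[ℝ] :=
  {z : ℍ[ℝ] | ∃ a b : ℝ, z = (a : ℍ[ℝ]) + (b : ℍ[ℝ]) * u}

/-- The 2-plane `Π_{p,s}` associated to nonzero pure vector quaternions `p, s`: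
if `ŝ ≠ −p̂` it is `u_{p,s} ℂ_{p̂}` with `u_{p,s} = (p̂ + ŝ)/|p̂ + ŝ|`; if `ŝ = −p̂`
it is the 2-plane of pure vector quaternions orthogonal to `p̂`. -/
noncomputable def PiPlane (p s : ℍ[ℝ]) : Set ℍ[ℝ] :=
  if ‖s‖⁻¹ • s = -(‖p‖⁻¹ • p) then
    {v : ℍ[ℝ] | v.re = 0 ∧ ⟪v, ‖p‖⁻¹ • p⟫_ℝ = 0}
  else
    (fun z => (‖‖p‖⁻¹ • p + ‖s‖⁻¹ • s‖⁻¹ • (‖p‖⁻¹ • p + ‖s‖⁻¹ • s)) * z) ''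
      complexPlane (‖p‖⁻¹ • p)

/-- The normalization of a nonzero pure quaternion squares to `-1`. -/
theorem normalized_mul_self_of_re_eq_zero {p : ℍ[ℝ]} (hp : p.re = 0) (hp0 : p ≠ 0) :
    (‖p‖⁻¹ • p) * (‖p‖⁻¹ • p) = -1 := by
  have hn : ‖p‖ ≠ 0 := norm_ne_zero_iff.mpr hp0
  have hstar : star p = -p := Quaternion.star_eq_neg.mpr hp
  have hpp : p * p = -((‖p‖ * ‖p‖ : ℝ) : ℍ[ℝ]) := by
    rw [← Quaternion.normSq_eq_norm_mul_self, ← Quaternion.self_mul_star, hstar, mul_neg, neg_neg]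
  rw [smul_mul_smul_comm, hpp, smul_neg, Quaternion.smul_coe]
  field_simp
  simp

/-- Orthogonal pure quaternions anticommute. -/
theorem mul_eq_neg_mul_of_inner_eq_zero {u v : ℍ[ℝ]} (hu : u.re = 0) (hv : v.re = 0)
    (h : ⟪u, v⟫_ℝ = 0) : u * v = -(v * u) := by
  rw [Quaternion.inner_def] at h
  simp only [Quaternion.re_mul, Quaternion.re_star, Quaternion.imI_star, Quaternion.imJ_star,
    Quaternion.imK_star, hu, hv] at h
  ext <;> simp [hu, hv] <;> linarith

/-- Every element `u` of `PiPlane p s` intertwines the normalizations of `p` and `s`. -/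
theorem mul_normalized_eq_of_mem_PiPlane {p s u : ℍ[ℝ]} (hp : p.re = 0) (hs : s.re = 0)
    (hp0 : p ≠ 0) (hs0 : s ≠ 0) (hu : u ∈ PiPlane p s) :
    u * (‖p‖⁻¹ • p) = (‖s‖⁻¹ • s) * u := by
  have hpp := normalized_mul_self_of_re_eq_zero hp hp0
  have hss := normalized_mul_self_of_re_eq_zero hs hs0
  have hre : (‖p‖⁻¹ • p).re = 0 := by simp [hp]
  unfold PiPlane at hu
  generalize ‖p‖⁻¹ • p = a at *
  generalize ‖s‖⁻¹ • s = b at *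
  split_ifs at hu with h
  · rw [h, neg_mul]
    exact mul_eq_neg_mul_of_inner_eq_zero hu.1 hre hu.2
  · obtain ⟨_, ⟨x, y, rfl⟩, rfl⟩ := hu
    have hcomm : ((x : ℍ[ℝ]) + y * a) * a = a * (x + y * a) := by
      rw [add_mul, mul_add, Quaternion.coe_commutes x a, ← mul_assoc a,
        ← Quaternion.coe_commutes y a]
    have hab : (a + b) * a = b * (a + b) := by
      rw [add_mul, mul_add, hpp, hss, add_comm]
    simp only [smul_mul_assoc, mul_smul_comm]
    rw [mul_assoc, hcomm, ← mul_assoc, hab, mul_assoc]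

/-- if `U ∈ Π_{p,s}` is a unit quaternion, then `U p̂ U* = ŝ`. -/
theorem unit_in_PiPlane_conjugates (p s : ℍ[ℝ]) (hp : p.re = 0) (hs : s.re = 0)
    (hp0 : p ≠ 0) (hs0 : s ≠ 0) (U : ℍ[ℝ]) (hU : U ∈ PiPlane p s) (hU1 : ‖U‖ = 1) :
    U * (‖p‖⁻¹ • p) * star U = ‖s‖⁻¹ • s := by
  rw [mul_normalized_eq_of_mem_PiPlane hp hs hp0 hs0 hU, mul_assoc, Quaternion.self_mul_star,
    Quaternion.normSq_eq_norm_mul_self, hU1]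
  simp
end

section
/- Let P, Q, R, S ∈ ℍ with P ∉ ℝ, write p0 = scal(P) and p = vect(P) ≠ 0, and define R̃ = (Q*P − RP*)(P − P*)^{-1} and S̃ = S + (Q*PR* + RP*Q)/|P − P*|² + R(P* − P)Q/|P − P*|² − Q*P*Q/|P − P*|² − RP*R*/|P − P*|², with s̃0 = scal(S̃) and s̃ = vect(S̃). Suppose S̃ ∉ ℝ (i.e., s̃ ≠ 0) and R̃ is orthogonal to the 2-plane Π_{p,s̃} with respect to the Euclidean inner product on ℍ ≅ ℝ⁴. If s̃0|p| = p0|s̃|, then the set of solutions X ∈ ℍ of X P X* + X Q + R X* = S is exactly the translated circle C_{p,s̃} − (R − Q*)(P − P*)^{-1}; if s̃0|p| ≠ p0|s̃|, there is no solution. -/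
open Quaternion
open scoped InnerProductSpace Classical

/-- A quaternion commuting with a unit pure quaternion `u` lies in `ℂ_u`. -/
lemma mem_complexPlane_of_commute {u z : ℍ[ℝ]} (hre : u.re = 0) (hu : u * u = -1)
    (h : z * u = u * z) : z ∈ complexPlane u := by
  refine ⟨z.re, -(z * u).re, ?_⟩
  have h0 := congrArg QuaternionAlgebra.re hu
  have h1 := congrArg QuaternionAlgebra.imI h
  have h2 := congrArg QuaternionAlgebra.imJ h
  have h3 := congrArg QuaternionAlgebra.imK h
  simp [hre] at h0 h1 h2 h3
  ext <;> simp [hre]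
  · linear_combination z.imI * h0 + u.imJ / 2 * h3 - u.imK / 2 * h2
  · linear_combination z.imJ * h0 + u.imK / 2 * h1 - u.imI / 2 * h3
  · linear_combination z.imK * h0 + u.imI / 2 * h2 - u.imJ / 2 * h1

lemma mul_self_of_re_eq_zero {p : ℍ[ℝ]} (hre : p.re = 0) :
    p * p = -((‖p‖ ^ 2 : ℝ) : ℍ[ℝ]) := by
  have h : star p = -p := by ext <;> simp [hre]
  rw [sq, ← Quaternion.normSq_eq_norm_mul_self, ← Quaternion.self_mul_star, h, mul_neg, neg_neg]

lemma normalize_mul_self {p : ℍ[ℝ]} (hre : p.re = 0) (hp : p ≠ 0) :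
    (‖p‖⁻¹ • p) * (‖p‖⁻¹ • p) = -1 := by
  rw [mul_self_of_re_eq_zero (by simp [hre]), norm_smul, norm_inv, norm_norm,
    inv_mul_cancel₀ (norm_ne_zero_iff.2 hp)]
  simp

/-- `Π_{p,s}` is the plane of quaternions intertwining `p̂` and `ŝ`. -/
lemma mem_PiPlane_iff {p s : ℍ[ℝ]} (hpre : p.re = 0) (hsre : s.re = 0) (hp : p ≠ 0)
    (hs : s ≠ 0) (Z : ℍ[ℝ]) :
    Z ∈ PiPlane p s ↔ Z * (‖p‖⁻¹ • p) = (‖s‖⁻¹ • s) * Z := by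
  have hu := normalize_mul_self hpre hp
  have hv := normalize_mul_self hsre hs
  have hure : (‖p‖⁻¹ • p).re = 0 := by simp [hpre]
  unfold PiPlane
  generalize ‖p‖⁻¹ • p = u at *
  generalize ‖s‖⁻¹ • s = v at *
  split_ifs with hvu
  · subst hvu
    have h0 := congrArg QuaternionAlgebra.re hu
    simp [hure] at h0
    simp only [Set.mem_ofPred_eq, Quaternion.inner_def]
    constructor
    · rintro ⟨hZ, hZu⟩
      simp [hZ, hure] at hZu
      ext <;> simp [hZ, hure] <;> linarith
    · intro h
      have h1 := congrArg QuaternionAlgebra.re h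
      have h2 := congrArg QuaternionAlgebra.imI h
      have h3 := congrArg QuaternionAlgebra.imJ h
      have h4 := congrArg QuaternionAlgebra.imK h
      simp [hure] at h1 h2 h3 h4
      constructor
      · linear_combination Z.re * h0 + u.imI / 2 * h2 + u.imJ / 2 * h3 + u.imK / 2 * h4
      · simp [hure]
        linarith
  · have hw : u + v ≠ 0 := fun h => hvu (eq_neg_of_add_eq_zero_right h)
    have hwu : (u + v) * u = v * (u + v) := by
      rw [add_mul, mul_add, hu, hv, add_comm]
    have hc : ‖u + v‖⁻¹ ≠ 0 := inv_ne_zero (norm_ne_zero_iff.2 hw)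
    have hx : ‖u + v‖⁻¹ • (u + v) ≠ 0 := smul_ne_zero hc hw
    have hxu : (‖u + v‖⁻¹ • (u + v)) * u = v * (‖u + v‖⁻¹ • (u + v)) := by
      rw [smul_mul_assoc, hwu, mul_smul_comm]
    generalize ‖u + v‖⁻¹ • (u + v) = x at *
    constructor
    · rintro ⟨z, ⟨a, b, rfl⟩, rfl⟩
      have : ((a : ℍ[ℝ]) + b * u) * u = u * (a + b * u) := by
        rw [add_mul, mul_add, Quaternion.coe_commutes, mul_assoc, ← mul_assoc u,
          ← Quaternion.coe_commutes b u, mul_assoc]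
      simp only
      rw [mul_assoc, this, ← mul_assoc, hxu, mul_assoc]
    · intro h
      refine ⟨x⁻¹ * Z, mem_complexPlane_of_commute hure hu ?_, mul_inv_cancel_left₀ hx Z⟩
      apply mul_left_cancel₀ hx
      rw [mul_assoc, mul_inv_cancel_left₀ hx, h, ← mul_assoc, hxu, mul_assoc,
        mul_inv_cancel_left₀ hx]

/-- The circle `C_{p,s}` is the set of solutions of `Z p Z* = s`. -/
lemma mul_mul_star_eq_iff {p s : ℍ[ℝ]} (hpre : p.re = 0) (hsre : s.re = 0) (hp : p ≠ 0)
    (hs : s ≠ 0) (Z : ℍ[ℝ]) :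
    Z * p * star Z = s ↔ Z ∈ PiPlane p s ∧ ‖Z‖ = Real.sqrt (‖s‖ / ‖p‖) := by
  have hp' := norm_pos_iff.2 hp
  have hs' := norm_pos_iff.2 hs
  rw [mem_PiPlane_iff hpre hsre hp hs, eq_comm (a := ‖Z‖),
    Real.sqrt_eq_iff_mul_self_eq (by positivity) (by positivity), eq_comm (b := ‖Z‖ * ‖Z‖),
    mul_smul_comm, smul_mul_assoc]
  constructor
  · intro h
    have hn : ‖Z‖ * ‖Z‖ = ‖s‖ / ‖p‖ := by
      rw [eq_div_iff hp'.ne', ← h, norm_mul, norm_mul, norm_star]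
      ring
    refine ⟨?_, hn⟩
    have h1 : s * Z = (‖s‖ / ‖p‖) • (Z * p) := by
      rw [← hn, ← Quaternion.normSq_eq_norm_mul_self, ← Quaternion.coe_mul_eq_smul,
        Quaternion.coe_commutes, ← Quaternion.star_mul_self, ← mul_assoc, h]
    rw [h1, smul_smul]
    congr 1
    field_simp
  · rintro ⟨h, hn⟩
    have h1 : Z * p = (‖p‖ / ‖s‖) • (s * Z) := by
      rw [div_eq_mul_inv, ← smul_smul, ← h, smul_smul, mul_inv_cancel₀ hp'.ne', one_smul]
    rw [h1, smul_mul_assoc, mul_assoc, Quaternion.self_mul_star,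
      Quaternion.normSq_eq_norm_mul_self, hn, ← Quaternion.coe_commutes,
      Quaternion.coe_mul_eq_smul, smul_smul]
    rw [show ‖p‖ / ‖s‖ * (‖s‖ / ‖p‖) = 1 by field_simp, one_smul]

/-- Translating by `T` turns the quadratic equation into one whose linear part is real-valued. -/
lemma translated_equation {P Q R T K : ℍ[ℝ]} (hT : T * (P - star P) = R - star Q)
    (hK : K = R - T * P) (Z : ℍ[ℝ]) :
    (Z - T) * P * star (Z - T) + (Z - T) * Q + R * star (Z - T)
      = Z * P * star Z + (2 * ⟪Z, K⟫_ℝ : ℝ) - (T * Q + R * star T - T * P * star T) := by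
  have hQ : Q = star R - star (P - star P) * star T := by
    rw [← star_mul, hT]
    simp
  have hin : ((2 * ⟪Z, K⟫_ℝ : ℝ) : ℍ[ℝ]) = Z * star K + K * star Z := by
    rw [Quaternion.inner_def]
    ext <;> simp <;> ring
  rw [hin, hK, hQ]
  simp only [star_sub, star_mul, star_star]
  noncomm_ring

lemma mul_mul_star_re (Z P : ℍ[ℝ]) : (Z * P * star Z).re = P.re * (‖Z‖ * ‖Z‖) := by
  rw [← Quaternion.normSq_eq_norm_mul_self, Quaternion.normSq_def']
  simp
  ring

lemma mul_mul_star_im (Z P : ℍ[ℝ]) : (Z * P * star Z).im = Z * P.im * star Z := by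
  ext <;> simp <;> ring

lemma constant_term_identity {P Q R T : ℍ[ℝ]} (hT : T * (P - star P) = R - star Q) :
    (star Q * P * star R + R * star P * Q) + R * (star P - P) * Q - star Q * star P * Q
      - R * star P * star R
      = (T * Q + R * star T - T * P * star T) * ((‖P - star P‖ ^ 2 : ℝ) : ℍ[ℝ]) := by
  have hN : ‖P - star P‖ ^ 2 = 4 * (P.imI ^ 2 + P.imJ ^ 2 + P.imK ^ 2) := by
    rw [sq, ← Quaternion.normSq_eq_norm_mul_self, Quaternion.normSq_def']
    simp
    ring
  generalize ‖P - star P‖ ^ 2 = N at hN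
  obtain rfl : R = T * (P - star P) + star Q := by rw [hT]; abel
  ext <;> simp <;> rw [hN] <;> ring

/-- for `P ∉ ℝ` with `S̃ ∉ ℝ` and `R̃ ⊥ Π_{p,s̃}`: if `s̃₀|p| = p₀|s̃|`
the solution set is the translated circle `C_{p,s̃} − (R − Q*)(P − P*)⁻¹`; otherwise
there is no solution. -/
theorem quadratic_quaternion_nonreal_circle_case (P Q R S : ℍ[ℝ]) (hP : P.im ≠ 0)
    (Rt St : ℍ[ℝ])
    (hRt : Rt = (star Q * P - R * star P) * (P - star P)⁻¹)
    (hSt : St = S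
      + (star Q * P * star R + R * star P * Q) / ((‖P - star P‖ ^ 2 : ℝ) : ℍ[ℝ])
      + R * (star P - P) * Q / ((‖P - star P‖ ^ 2 : ℝ) : ℍ[ℝ])
      - star Q * star P * Q / ((‖P - star P‖ ^ 2 : ℝ) : ℍ[ℝ])
      - R * star P * star R / ((‖P - star P‖ ^ 2 : ℝ) : ℍ[ℝ]))
    (hs : St.im ≠ 0)
    (horth : ∀ Z ∈ PiPlane P.im St.im, ⟪Z, Rt⟫_ℝ = 0) :
    (St.re * ‖P.im‖ = P.re * ‖St.im‖ →
      {X : ℍ[ℝ] | X * P * star X + X * Q + R * star X = S}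
        = (fun Z => Z - (R - star Q) * (P - star P)⁻¹) ''
            {Z : ℍ[ℝ] | Z ∈ PiPlane P.im St.im ∧ ‖Z‖ = Real.sqrt (‖St.im‖ / ‖P.im‖)}) ∧
    (St.re * ‖P.im‖ ≠ P.re * ‖St.im‖ →
      ¬ ∃ X : ℍ[ℝ], X * P * star X + X * Q + R * star X = S) := by
  have hp : P.im.re = 0 := by simp
  have hD : P - star P ≠ 0 := by
    intro h
    apply hP
    have h1 := congrArg QuaternionAlgebra.imI h
    have h2 := congrArg QuaternionAlgebra.imJ h
    have h3 := congrArg QuaternionAlgebra.imK h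
    simp at h1 h2 h3
    ext <;> simp <;> linarith
  obtain ⟨T, hTdef⟩ : ∃ T, T = (R - star Q) * (P - star P)⁻¹ := ⟨_, rfl⟩
  have hT : T * (P - star P) = R - star Q := by rw [hTdef, inv_mul_cancel_right₀ hD]
  have hK : Rt = R - T * P := by
    apply mul_right_cancel₀ hD
    rw [hRt, inv_mul_cancel_right₀ hD, sub_mul, mul_assoc T,
      show P * (P - star P) = (P - star P) * P by ext <;> simp <;> ring, ← mul_assoc T, hT]
    noncomm_ring
  have hN : ((‖P - star P‖ ^ 2 : ℝ) : ℍ[ℝ]) ≠ 0 := by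
    rw [← Quaternion.coe_zero, Ne, Quaternion.coe_inj]
    exact pow_ne_zero 2 (norm_ne_zero_iff.2 hD)
  have hSt' : St = S + (T * Q + R * star T - T * P * star T) := by
    rw [← mul_div_cancel_right₀ (T * Q + R * star T - T * P * star T) hN,
      ← constant_term_identity hT, hSt]
    simp only [add_div, sub_div]
    abel
  have key : ∀ Z : ℍ[ℝ], (Z - T) * P * star (Z - T) + (Z - T) * Q + R * star (Z - T) = S ↔
      (Z ∈ PiPlane P.im St.im ∧ ‖Z‖ = Real.sqrt (‖St.im‖ / ‖P.im‖)) ∧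
        St.re * ‖P.im‖ = P.re * ‖St.im‖ := by
    intro Z
    rw [translated_equation hT hK, sub_eq_iff_eq_add, ← hSt',
      ← mul_mul_star_eq_iff hp (by simp) hP hs]
    have hsplit : Z * P * star Z + (2 * ⟪Z, Rt⟫_ℝ : ℝ) = St ↔
        Z * P.im * star Z = St.im ∧ P.re * (‖Z‖ * ‖Z‖) + 2 * ⟪Z, Rt⟫_ℝ = St.re := by
      rw [← mul_mul_star_im, ← mul_mul_star_re]
      generalize 2 * ⟪Z, Rt⟫_ℝ = r
      constructor
      · intro h
        rw [← h]
        simp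
      · rintro ⟨h1, h2⟩
        rw [← Quaternion.re_add_im St, ← h1, ← h2]
        ext <;> simp
    rw [hsplit]
    refine and_congr_right fun h => ?_
    obtain ⟨hZ, hn⟩ := (mul_mul_star_eq_iff hp (by simp) hP hs Z).1 h
    rw [horth Z hZ, hn, Real.mul_self_sqrt (by positivity), mul_zero, add_zero, ← mul_div_assoc,
      div_eq_iff (norm_ne_zero_iff.2 hP), eq_comm]
  rw [← hTdef]
  constructor
  · intro h
    ext X
    simp only [Set.mem_ofPred_eq, Set.mem_image]
    constructor
    · intro hX
      exact ⟨X + T, ((key (X + T)).1 (by simpa using hX)).1, add_sub_cancel_right X T⟩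
    · rintro ⟨Z, hZ, rfl⟩
      exact (key Z).2 ⟨hZ, h⟩
  · rintro h ⟨X, hX⟩
    exact h ((key (X + T)).1 (by simpa using hX)).2
end
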